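/- arXiv:2412.06161 — 2 statements merged into one kernel-verified Lean document; each statement's English description precedes it below -/
import Mathlib

section
/- Let J be a finite index set with positive real weights n_j and positive reals p_j, t_j for j ∈ J, and let p_k > 0, t_k > 0 be reals. Define u = ∑_{j∈J} n_j·t_j, C₀ = ∑_{j∈J} n_j·p_j, T₁ = ⌊u/t_k⌋·t_k, and C₁ = p_k·⌊u/t_k⌋ + (C₀/u)·(u − T₁). If u ≥ t_k and t_j/p_j < t_k/p_k for every j ∈ J, then C₁ < C₀. Consequently, a configuration whose leftover workload for configuration c_k is at least t_k is not cost-minimal: reallocating T₁ of that workload to machines at configuration c_k strictly reduces the total cost. -/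
/-- First case of Theorem 2: if the leftover workload `u = ∑ n j * t j`
for configuration `c_k` is at least `tk`, and every configuration `j` has
strictly smaller throughput-cost ratio `t j / p j` than `tk / pk`, then
reallocating `T₁ = ⌊u / tk⌋ * tk` of the workload to machines at `c_k`
strictly reduces the total cost: `C₁ < C₀`. -/
theorem leftover_not_cost_min_case1
    {ι : Type*} (J : Finset ι) (n p t : ι → ℝ)
    (hn : ∀ j ∈ J, 0 < n j) (hp : ∀ j ∈ J, 0 < p j) (ht : ∀ j ∈ J, 0 < t j)
    (pk tk : ℝ) (hpk : 0 < pk) (htk : 0 < tk)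
    (C₀ u T₁ C₁ : ℝ)
    (hC₀ : C₀ = ∑ j ∈ J, n j * p j)
    (hu : u = ∑ j ∈ J, n j * t j)
    (hT₁ : T₁ = (⌊u / tk⌋ : ℝ) * tk)
    (hC₁ : C₁ = pk * (⌊u / tk⌋ : ℝ) + (C₀ / u) * (u - T₁))
    (hut : tk ≤ u)
    (hratio : ∀ j ∈ J, t j / p j < tk / pk) :
    C₁ < C₀ := by
  have hu_pos : 0 < u := htk.trans_le hut
  have hJ : J.Nonempty := by
    rw [Finset.nonempty_iff_ne_empty]
    rintro rfl
    simp [hu] at hu_pos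
  have hcost : pk * u < tk * C₀ := by
    rw [hu, hC₀, Finset.mul_sum, Finset.mul_sum]
    refine Finset.sum_lt_sum_of_nonempty hJ fun j hj => ?_
    have h := (div_lt_div_iff₀ (hp j hj) hpk).mp (hratio j hj)
    linarith [mul_lt_mul_of_pos_left h (hn j hj)]
  have hprice : pk < C₀ / u * tk := by
    rw [div_mul_eq_mul_div, lt_div_iff₀ hu_pos]
    linarith
  have hfloor : (0 : ℝ) < ⌊u / tk⌋ := by
    exact_mod_cast Int.floor_pos.mpr ((one_le_div htk).mpr hut)
  have hC₀_eq : C₀ / u * u = C₀ := div_mul_cancel₀ C₀ hu_pos.ne'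
  rw [hC₁, hT₁]
  linarith [mul_lt_mul_of_pos_right hprice hfloor]
end

section
/- Let J be a finite index set with positive real weights n_j and positive reals p_j, t_j for j ∈ J, and let p_k, t_k, p_β, t_β be positive reals. Define u = ∑_{j∈J} n_j·t_j, C₀ = ∑_{j∈J} n_j·p_j, T₁ = ⌊u/t_k⌋·t_k, and C₂ = p_k·⌊u/t_k⌋ + p_β·(u − T₁)/t_β. Assume (i) u ≥ t_k, (ii) t_j/p_j < t_k/p_k for every j ∈ J, and (iii) p_β/t_β − C₀/u ≤ C₀/u − p_k/t_k. Then C₂ < C₀. -/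
/-- Second case of Theorem 2: if the leftover workload `u = ∑ n j * t j`
for configuration `c_k` is at least `tk`, every configuration `j` has
strictly smaller throughput-cost ratio `t j / p j` than `tk / pk`, and the
price-per-throughput gaps satisfy
`pβ / tβ - C₀ / u ≤ C₀ / u - pk / tk`, then the reallocation is strictly
cheaper: `C₂ < C₀`. -/
theorem leftover_not_cost_min_case2
    {ι : Type*} (J : Finset ι) (n p t : ι → ℝ)
    (hn : ∀ j ∈ J, 0 < n j) (hp : ∀ j ∈ J, 0 < p j) (ht : ∀ j ∈ J, 0 < t j)
    (pk tk pβ tβ : ℝ) (hpk : 0 < pk) (htk : 0 < tk) (hpβ : 0 < pβ) (htβ : 0 < tβ)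
    (C₀ u T₁ C₂ : ℝ)
    (hC₀ : C₀ = ∑ j ∈ J, n j * p j)
    (hu : u = ∑ j ∈ J, n j * t j)
    (hT₁ : T₁ = (⌊u / tk⌋ : ℝ) * tk)
    (hC₂ : C₂ = pk * (⌊u / tk⌋ : ℝ) + pβ * (u - T₁) / tβ)
    (hut : tk ≤ u)
    (hratio : ∀ j ∈ J, t j / p j < tk / pk)
    (hgap : pβ / tβ - C₀ / u ≤ C₀ / u - pk / tk) :
    C₂ < C₀ := by
  have hu0 : 0 < u := htk.trans_le hut
  have hJ : J.Nonempty := by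
    by_contra h
    rw [Finset.not_nonempty_iff_eq_empty] at h
    simp [hu, h] at hu0
  have hcost : pk * u < C₀ * tk := by
    rw [hu, hC₀, Finset.mul_sum, Finset.sum_mul]
    refine Finset.sum_lt_sum_of_nonempty hJ fun j hj => ?_
    have h := (div_lt_div_iff₀ (hp j hj) hpk).1 (hratio j hj)
    nlinarith [mul_lt_mul_of_pos_left h (hn j hj)]
  have havg : pk / tk < C₀ / u := (div_lt_div_iff₀ htk hu0).2 hcost
  have hfloor : (1 : ℝ) ≤ (⌊u / tk⌋ : ℝ) := by
    exact_mod_cast Int.le_floor.2 (by simpa using (one_le_div htk).2 hut)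
  have hT₁_ge : tk ≤ T₁ := by
    rw [hT₁]
    exact le_mul_of_one_le_left htk.le hfloor
  have hres_nonneg : 0 ≤ u - T₁ := by
    rw [hT₁, sub_nonneg]
    exact (le_div_iff₀ htk).1 (Int.floor_le _)
  have hres_lt : u - T₁ < tk := by
    have h := (div_lt_iff₀ htk).1 (Int.lt_floor_add_one (u / tk))
    rw [hT₁]
    linarith
  have hC₂_eq : C₂ = pk / tk * T₁ + pβ / tβ * (u - T₁) := by
    rw [hC₂, mul_div_right_comm]
    congr 1
    rw [hT₁]
    field_simp
  have hC₀_eq : C₀ = C₀ / u * u := (div_mul_cancel₀ C₀ hu0.ne').symm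
  rw [hC₂_eq, hC₀_eq]
  nlinarith [mul_le_mul_of_nonneg_right hgap hres_nonneg,
    mul_pos (sub_pos.2 havg) (sub_pos.2 (hres_lt.trans_le hT₁_ge))]
end
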